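/- arXiv:1411.0089 — 3 statements merged into one kernel-verified Lean document; each statement's English description precedes it below -/
import Mathlib

section
/- (Korn's inequality with parameter δ.) There exists a constant K, independent of δ, such that for every 0<δ≤1 and every pair (u,v) of sufficiently smooth functions on Ω satisfying u_x + v_y = 0 in Ω and u = v = 0 on Σ, one has ∬_Ω (δ² u_x² + u_y² + δ⁴ v_x² + δ² v_y²) dx dy ≤ K ∬_Ω ( 2δ² u_x² + (u_y + δ² v_x)² + 2δ² v_y² ) dx dy. -/
open MeasureTheory Real

noncomputable section

/-- Functions on the strip `Ω = 𝕋 × (0,1)` (the flat torus `𝕋 = ℝ/ℤ` is modelled by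
`1`-periodic functions of `x ∈ ℝ`); arguments `(x, y)`. -/
abbrev SF : Type := ℝ → ℝ → ℝ

/-- Partial derivative in the horizontal variable `x`. -/
def pdx (f : SF) : SF := fun x y => deriv (fun s => f s y) x
/-- Partial derivative in the vertical variable `y`. -/
def pdy (f : SF) : SF := fun x y => deriv (fun s => f x s) y
/-- Iterated `x`-derivative `∂_x^n`. -/
def pdxn (n : ℕ) (f : SF) : SF := pdx^[n] f
/-- Iterated `y`-derivative `∂_y^n`. -/
def pdyn (n : ℕ) (f : SF) : SF := pdy^[n] f

/-- Squared `L²(Ω)` norm `‖f‖²`. -/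
def nSq (f : SF) : ℝ := ∫ x in (0:ℝ)..1, ∫ y in (0:ℝ)..1, (f x y)^2
/-- Squared trace norm `|f|₀²` on `Γ = {y = 1}`. -/
def trSq (f : SF) : ℝ := ∫ x in (0:ℝ)..1, (f x 1)^2
/-- `L^∞(Ω)` norm (for continuous `1`-periodic functions). -/
def linf (f : SF) : ℝ := ⨆ q : Set.Icc (0:ℝ) 1 × Set.Icc (0:ℝ) 1, |f q.1.1 q.2.1|
/-- The vertical antiderivative `∂_y^{-1} f (x,y) = -∫_y^1 f(x,z) dz`. -/
def iy (f : SF) : SF := fun x y => -∫ z in y..1, f x z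

/-- "Sufficiently smooth" function on `Ω`: smooth and `1`-periodic in `x`. -/
def SmoothF (f : SF) : Prop :=
  (∀ n : ℕ, ContDiff ℝ n (fun q : ℝ × ℝ => f q.1 q.2)) ∧
    ∀ y : ℝ, Function.Periodic (fun x => f x y) 1

/-- Smooth `1`-periodic function on `𝔾 = 𝕋`. -/
def SmoothP (g : ℝ → ℝ) : Prop :=
  (∀ n : ℕ, ContDiff ℝ n g) ∧ Function.Periodic g 1

/-- `n`-th Fourier coefficient of a `1`-periodic function. -/
def fc (g : ℝ → ℝ) (n : ℤ) : ℂ :=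
  ∫ x in (0:ℝ)..1, Complex.exp (-(2 * π * (n : ℝ) * x : ℝ) * Complex.I) * (g x : ℂ)

/-- Squared norm `| |D_x|^{1/2} g |₀²`, where `|D_x|` is the Fourier multiplier in `x`
with symbol `2π|n|`; computed via Plancherel. -/
def halfSq (g : ℝ → ℝ) : ℝ := ∑' n : ℤ, (2 * π * |(n : ℝ)|) * ‖fc g n‖ ^ 2

theorem pdx_eq_fderiv {f : SF} (hf : Differentiable ℝ (fun q : ℝ × ℝ => f q.1 q.2)) (x y : ℝ) :
    pdx f x y = fderiv ℝ (fun q : ℝ × ℝ => f q.1 q.2) (x, y) (1, 0) := by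
  have h : HasDerivAt (fun s : ℝ => (s, y)) ((1 : ℝ), (0 : ℝ)) x :=
    (hasDerivAt_id x).prodMk (hasDerivAt_const x y)
  exact ((hf (x, y)).hasFDerivAt.comp_hasDerivAt x h).deriv

theorem pdy_eq_fderiv {f : SF} (hf : Differentiable ℝ (fun q : ℝ × ℝ => f q.1 q.2)) (x y : ℝ) :
    pdy f x y = fderiv ℝ (fun q : ℝ × ℝ => f q.1 q.2) (x, y) (0, 1) := by
  have h : HasDerivAt (fun s : ℝ => (x, s)) ((0 : ℝ), (1 : ℝ)) y :=
    (hasDerivAt_const y x).prodMk (hasDerivAt_id y)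
  exact ((hf (x, y)).hasFDerivAt.comp_hasDerivAt y h).deriv

theorem continuous_pdx {f : SF} (hf : ContDiff ℝ 1 (fun q : ℝ × ℝ => f q.1 q.2)) :
    Continuous (fun q : ℝ × ℝ => pdx f q.1 q.2) := by
  simp only [pdx_eq_fderiv (hf.differentiable one_ne_zero)]
  exact (hf.continuous_fderiv one_ne_zero).clm_apply continuous_const

theorem continuous_pdy {f : SF} (hf : ContDiff ℝ 1 (fun q : ℝ × ℝ => f q.1 q.2)) :
    Continuous (fun q : ℝ × ℝ => pdy f q.1 q.2) := by
  simp only [pdy_eq_fderiv (hf.differentiable one_ne_zero)]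
  exact (hf.continuous_fderiv one_ne_zero).clm_apply continuous_const

/-- The integral of the Jacobian determinant of `(u, w)` over `(0,1) × (a,1)` only depends on the
traces at `y = 1`, if everything is periodic in `x` and `w` vanishes at `y = a`. -/
theorem integral_jacobian_eq_trace {u w : SF}
    (hu : ContDiff ℝ 2 (fun q : ℝ × ℝ => u q.1 q.2))
    (hw : ContDiff ℝ 1 (fun q : ℝ × ℝ => w q.1 q.2))
    (hup : ∀ y, Function.Periodic (fun x => u x y) 1)
    (hwp : ∀ y, Function.Periodic (fun x => w x y) 1)
    {a : ℝ} (ha : ∀ x, w x a = 0) :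
    ∫ x in (0:ℝ)..1, ∫ y in a..1, (pdx u x y * pdy w x y - pdy u x y * pdx w x y) =
      ∫ x in (0:ℝ)..1, pdx u x 1 * w x 1 := by
  have hud := hu.differentiable two_ne_zero
  have hwd := hw.differentiable one_ne_zero
  set U : ℝ × ℝ → ℝ := fun q => u q.1 q.2 with hU
  set W : ℝ × ℝ → ℝ := fun q => w q.1 q.2 with hW
  have hG : ContDiff ℝ 1 (fderiv ℝ U) := hu.fderiv_right (by norm_num)
  have hsymm : ∀ q, fderiv ℝ (fderiv ℝ U) q (1, 0) (0, 1) =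
      fderiv ℝ (fderiv ℝ U) q (0, 1) (1, 0) := fun q =>
    (hu.contDiffAt.isSymmSndFDerivAt (by simp)) (1, 0) (0, 1)
  have hprod : ∀ e : ℝ × ℝ, ContDiff ℝ 1 (fun q => fderiv ℝ U q e * W q) := fun e =>
    (hG.clm_apply contDiff_const).mul hw
  have hder : ∀ e d q, fderiv ℝ (fun q => fderiv ℝ U q e * W q) q d =
      fderiv ℝ (fderiv ℝ U) q d e * W q + fderiv ℝ U q e * fderiv ℝ W q d := by
    intro e d q
    have h1 : HasFDerivAt (fun q => fderiv ℝ U q e)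
        ((ContinuousLinearMap.apply ℝ ℝ e).comp (fderiv ℝ (fderiv ℝ U) q)) q :=
      (ContinuousLinearMap.apply ℝ ℝ e).hasFDerivAt.comp q
        (hG.differentiable one_ne_zero q).hasFDerivAt
    refine (congrArg (· d) (h1.mul (hwd q).hasFDerivAt).fderiv).trans ?_
    simp
    ring
  have key := integral2_divergence_prod_of_hasFDerivAt_off_countable
    (fun q => -(fderiv ℝ U q (0, 1) * W q)) (fun q => fderiv ℝ U q (1, 0) * W q)
    (fun q => -(fderiv ℝ (fun q => fderiv ℝ U q (0, 1) * W q) q))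
    (fun q => fderiv ℝ (fun q => fderiv ℝ U q (1, 0) * W q) q)
    0 a 1 1 ∅ Set.countable_empty
    (hprod _).continuous.neg.continuousOn (hprod _).continuous.continuousOn
    (fun q _ => ((hprod _).differentiable one_ne_zero q).hasFDerivAt.neg)
    (fun q _ => ((hprod _).differentiable one_ne_zero q).hasFDerivAt)
    (by
      have h0 := (hprod (0, 1)).continuous_fderiv one_ne_zero
      have h1 := (hprod (1, 0)).continuous_fderiv one_ne_zero
      refine ContinuousOn.integrableOn_compact (isCompact_uIcc.prod isCompact_uIcc) ?_
      exact ((h0.neg.clm_apply continuous_const).add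
        (h1.clm_apply continuous_const)).continuousOn)
  have hper : ∀ y, fderiv ℝ U (1, y) (0, 1) = fderiv ℝ U (0, y) (0, 1) := by
    intro y
    rw [← pdy_eq_fderiv hud, ← pdy_eq_fderiv hud]
    have : ∀ s, u 1 s = u 0 s := fun s => by simpa using hup s 0
    simp only [pdy, this]
  have hwper : ∀ y, W (1, y) = W (0, y) := fun y => by simpa using hwp y 0
  have hWa : ∀ x, W (x, a) = 0 := ha
  simp only [hper, hwper, hWa, mul_zero, intervalIntegral.integral_zero, sub_zero,
    add_sub_cancel_right] at key
  simp only [pdx_eq_fderiv hud, pdy_eq_fderiv hud, pdx_eq_fderiv hwd, pdy_eq_fderiv hwd]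
  refine Eq.trans ?_ key
  refine intervalIntegral.integral_congr fun x _ => intervalIntegral.integral_congr fun y _ => ?_
  simp only [neg_apply, hder, hsymm]
  ring

/-- **Korn's inequality with parameter `δ`** (Lemma 3.1).
There is a constant `K`, independent of `δ`, such that for every `0 < δ ≤ 1` and every
(sufficiently smooth) pair `(u,v)` with `u_x + v_y = 0` in `Ω` and `u = v = 0` on
`Σ = {y = 0}`, one has
`∬_Ω (δ²u_x² + u_y² + δ⁴v_x² + δ²v_y²) ≤ K ∬_Ω (2δ²u_x² + (u_y + δ²v_x)² + 2δ²v_y²)`. -/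
theorem korn_inequality_delta :
    ∃ K : ℝ, 0 < K ∧ ∀ δ : ℝ, δ ∈ Set.Ioc (0:ℝ) 1 → ∀ u v : SF, SmoothF u → SmoothF v →
      (∀ x : ℝ, ∀ y ∈ Set.Ioo (0:ℝ) 1, pdx u x y + pdy v x y = 0) →
      (∀ x : ℝ, u x 0 = 0 ∧ v x 0 = 0) →
      δ^2 * nSq (pdx u) + nSq (pdy u) + δ^4 * nSq (pdx v) + δ^2 * nSq (pdy v) ≤
        K * (2 * δ^2 * nSq (pdx u) + nSq (fun x y => pdy u x y + δ^2 * pdx v x y)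
          + 2 * δ^2 * nSq (pdy v)) := by
  refine ⟨6, by norm_num, ?_⟩
  rintro δ - u v ⟨hu, hup⟩ ⟨hv, hvp⟩ - h0
  have hu2 : ContDiff ℝ 2 (fun q : ℝ × ℝ => u q.1 q.2) := hu 2
  have hu1 : ContDiff ℝ 1 (fun q : ℝ × ℝ => u q.1 q.2) := hu 1
  have hv1 : ContDiff ℝ 1 (fun q : ℝ × ℝ => v q.1 q.2) := hv 1
  have cux := continuous_pdx hu1
  have cuy := continuous_pdy hu1
  have cvx := continuous_pdx hv1
  have cvy := continuous_pdy hv1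
  -- compare `v` with its compression towards `y = 1`, which has the same trace there
  set w : SF := fun x y => v x (4 * y + (-3)) with hwdef
  have hw1 : ContDiff ℝ 1 (fun q : ℝ × ℝ => w q.1 q.2) :=
    hv1.comp (contDiff_fst.prodMk ((contDiff_const.mul contDiff_snd).add contDiff_const))
  have cwx := continuous_pdx hw1
  have cwy := continuous_pdy hw1
  have hwx : ∀ x y, pdx w x y = pdx v x (4 * y + (-3)) := fun _ _ => rfl
  have hwy : ∀ x y, pdy w x y = 4 * pdy v x (4 * y + (-3)) := by
    intro x y
    have hd : DifferentiableAt ℝ (fun s => v x s) (4 * y + (-3)) :=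
      ((hv1.comp (contDiff_const.prodMk contDiff_id)).differentiable one_ne_zero) _
    have h := hd.hasDerivAt.comp y (((hasDerivAt_id y).const_mul 4).add_const (-3))
    refine h.deriv.trans ?_
    simp only [pdy]
    ring
  have hJ : (∫ x in (0:ℝ)..1, ∫ y in (0:ℝ)..1,
        (pdx u x y * pdy v x y - pdy u x y * pdx v x y)) =
      ∫ x in (0:ℝ)..1, ∫ y in (3/4:ℝ)..1,
        (pdx u x y * pdy w x y - pdy u x y * pdx w x y) := by
    rw [integral_jacobian_eq_trace hu2 hv1 hup hvp (fun x => (h0 x).2),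
      integral_jacobian_eq_trace hu2 hw1 hup (fun y => hvp _)
        (fun x => by norm_num [hwdef, (h0 x).2])]
    norm_num [hwdef]
  have hI : ∀ {f : SF} (_ : Continuous (fun q : ℝ × ℝ => f q.1 q.2)) (a b x : ℝ),
      IntervalIntegrable (fun y => f x y) volume a b := fun hf a b x =>
    (hf.comp (continuous_const.prodMk continuous_id)).intervalIntegrable a b
  have hO : ∀ {f : SF} (_ : Continuous (fun q : ℝ × ℝ => f q.1 q.2)) (a b : ℝ),
      IntervalIntegrable (fun x => ∫ y in a..b, f x y) volume 0 1 := fun hf a b =>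
    (intervalIntegral.continuous_parametric_intervalIntegral_of_continuous' hf a b
      ).intervalIntegrable 0 1
  have cj1 : Continuous (fun q : ℝ × ℝ =>
      pdx u q.1 q.2 * pdy v q.1 q.2 - pdy u q.1 q.2 * pdx v q.1 q.2) :=
    (cux.mul cvy).sub (cuy.mul cvx)
  have cj4 : Continuous (fun q : ℝ × ℝ =>
      pdx u q.1 q.2 * pdy w q.1 q.2 - pdy u q.1 q.2 * pdx w q.1 q.2) :=
    (cux.mul cwy).sub (cuy.mul cwx)
  have cE : Continuous (fun q : ℝ × ℝ => (pdy u q.1 q.2 + δ^2 * pdx v q.1 q.2)^2) :=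
    (cuy.add (continuous_const.mul cvx)).pow 2
  have iP := hI (f := fun x y => (pdx u x y)^2) (cux.pow 2)
  have iQ := hI (f := fun x y => (pdy u x y)^2) (cuy.pow 2)
  have iR := hI (f := fun x y => (pdx v x y)^2) (cvx.pow 2)
  have iT := hI (f := fun x y => (pdy v x y)^2) (cvy.pow 2)
  have iRw := hI (f := fun x y => (pdx w x y)^2) (cwx.pow 2)
  have iTw := hI (f := fun x y => (pdy w x y)^2) (cwy.pow 2)
  have iE := hI (f := fun x y => (pdy u x y + δ^2 * pdx v x y)^2) cE
  have i1 := hI (f := fun x y => pdx u x y * pdy v x y - pdy u x y * pdx v x y) cj1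
  have i4 := hI (f := fun x y => pdx u x y * pdy w x y - pdy u x y * pdx w x y) cj4
  have oP := hO (f := fun x y => (pdx u x y)^2) (cux.pow 2) 0 1
  have oQ := hO (f := fun x y => (pdy u x y)^2) (cuy.pow 2) 0 1
  have oR := hO (f := fun x y => (pdx v x y)^2) (cvx.pow 2) 0 1
  have oT := hO (f := fun x y => (pdy v x y)^2) (cvy.pow 2) 0 1
  have oE := hO (f := fun x y => (pdy u x y + δ^2 * pdx v x y)^2) cE 0 1
  have o1 := hO (f := fun x y => pdx u x y * pdy v x y - pdy u x y * pdx v x y) cj1 0 1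
  have o4 := hO (f := fun x y => pdx u x y * pdy w x y - pdy u x y * pdx w x y) cj4 (3/4) 1
  have hslice1 : ∀ x, (∫ y in (0:ℝ)..1, (pdy u x y)^2) + δ^4 * (∫ y in (0:ℝ)..1, (pdx v x y)^2) ≤
      (∫ y in (0:ℝ)..1, (pdy u x y + δ^2 * pdx v x y)^2) +
      2 * δ^2 * (∫ y in (0:ℝ)..1, (pdx u x y * pdy v x y - pdy u x y * pdx v x y)) +
      δ^2 * (∫ y in (0:ℝ)..1, (pdx u x y)^2) + δ^2 * (∫ y in (0:ℝ)..1, (pdy v x y)^2) := by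
    intro x
    simp only [← intervalIntegral.integral_const_mul]
    rw [← intervalIntegral.integral_add (iQ 0 1 x) ((iR 0 1 x).const_mul _),
      ← intervalIntegral.integral_add (iE 0 1 x) ((i1 0 1 x).const_mul _),
      ← intervalIntegral.integral_add ((iE 0 1 x).add ((i1 0 1 x).const_mul _))
        ((iP 0 1 x).const_mul _),
      ← intervalIntegral.integral_add (((iE 0 1 x).add ((i1 0 1 x).const_mul _)).add
        ((iP 0 1 x).const_mul _)) ((iT 0 1 x).const_mul _)]
    refine intervalIntegral.integral_mono_on zero_le_one
      ((iQ 0 1 x).add ((iR 0 1 x).const_mul _))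
      ((((iE 0 1 x).add ((i1 0 1 x).const_mul _)).add
        ((iP 0 1 x).const_mul _)).add ((iT 0 1 x).const_mul _)) fun y _ => ?_
    linarith [sq_nonneg (δ * (pdx u x y + pdy v x y))]
  have hslice4 : ∀ x, 2 * δ^2 * (∫ y in (3/4:ℝ)..1,
        (pdx u x y * pdy w x y - pdy u x y * pdx w x y)) ≤
      4 * δ^2 * (∫ y in (0:ℝ)..1, (pdx u x y)^2) + δ^2 * (∫ y in (0:ℝ)..1, (pdy v x y)^2) +
      1/2 * (∫ y in (0:ℝ)..1, (pdy u x y)^2) +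
      1/2 * δ^4 * (∫ y in (0:ℝ)..1, (pdx v x y)^2) := by
    intro x
    have hsub : ∀ f : ℝ → ℝ, IntervalIntegrable (fun y => (f y)^2) volume 0 1 →
        (∫ y in (3/4:ℝ)..1, (f y)^2) ≤ ∫ y in (0:ℝ)..1, (f y)^2 := fun f hf =>
      intervalIntegral.integral_mono_interval (by norm_num) (by norm_num) le_rfl
        (Filter.Eventually.of_forall fun y => sq_nonneg (f y)) hf
    have hP := hsub _ (iP 0 1 x)
    have hQ := hsub _ (iQ 0 1 x)
    have hR : (∫ y in (3/4:ℝ)..1, (pdx w x y)^2) = 1/4 * ∫ y in (0:ℝ)..1, (pdx v x y)^2 := by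
      simp only [hwx]
      rw [intervalIntegral.integral_comp_mul_add (fun y => (pdx v x y)^2) four_ne_zero]
      norm_num
    have hT : (∫ y in (3/4:ℝ)..1, (pdy w x y)^2) = 4 * ∫ y in (0:ℝ)..1, (pdy v x y)^2 := by
      simp only [hwy]
      rw [intervalIntegral.integral_comp_mul_add (fun y => (4 * pdy v x y)^2) four_ne_zero]
      simp only [mul_pow, intervalIntegral.integral_const_mul]
      norm_num
      ring
    have hmono : 2 * δ^2 * (∫ y in (3/4:ℝ)..1,
        (pdx u x y * pdy w x y - pdy u x y * pdx w x y)) ≤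
        4 * δ^2 * (∫ y in (3/4:ℝ)..1, (pdx u x y)^2) +
        1/4 * δ^2 * (∫ y in (3/4:ℝ)..1, (pdy w x y)^2) +
        1/2 * (∫ y in (3/4:ℝ)..1, (pdy u x y)^2) +
        2 * δ^4 * (∫ y in (3/4:ℝ)..1, (pdx w x y)^2) := by
      simp only [← intervalIntegral.integral_const_mul]
      have s1 := (iP (3/4) 1 x).const_mul (4 * δ^2)
      have s2 := (iTw (3/4) 1 x).const_mul (1/4 * δ^2)
      have s3 := (iQ (3/4) 1 x).const_mul (1/2)
      have s4 := (iRw (3/4) 1 x).const_mul (2 * δ^4)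
      rw [← intervalIntegral.integral_add s1 s2, ← intervalIntegral.integral_add (s1.add s2) s3,
        ← intervalIntegral.integral_add ((s1.add s2).add s3) s4]
      refine intervalIntegral.integral_mono_on (by norm_num) ((i4 _ _ x).const_mul _)
        (((s1.add s2).add s3).add s4) fun y _ => ?_
      linarith [sq_nonneg (δ * (4 * pdx u x y - pdy w x y)),
        sq_nonneg (δ * (2 * pdx u x y - pdy w x y / 2)),
        sq_nonneg (pdy u x y + 2 * δ^2 * pdx w x y)]
    rw [hR, hT] at hmono
    linarith [mul_le_mul_of_nonneg_left hP (by positivity : 0 ≤ 4 * δ^2)]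
  have hmono1 := intervalIntegral.integral_mono (μ := volume) zero_le_one
    (oQ.add (oR.const_mul (δ^4)))
    (((oE.add (o1.const_mul (2 * δ^2))).add (oP.const_mul (δ^2))).add (oT.const_mul (δ^2))) hslice1
  have hmono4 := intervalIntegral.integral_mono (μ := volume) zero_le_one
    (o4.const_mul (2 * δ^2))
    ((((oP.const_mul (4 * δ^2)).add (oT.const_mul (δ^2))).add (oQ.const_mul (1/2))).add
      (oR.const_mul (1/2 * δ^4))) hslice4
  rw [intervalIntegral.integral_add oQ (oR.const_mul _),
    intervalIntegral.integral_add ((oE.add (o1.const_mul _)).add (oP.const_mul _))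
      (oT.const_mul _),
    intervalIntegral.integral_add (oE.add (o1.const_mul _)) (oP.const_mul _),
    intervalIntegral.integral_add oE (o1.const_mul _)] at hmono1
  rw [intervalIntegral.integral_add
      (((oP.const_mul _).add (oT.const_mul _)).add (oQ.const_mul _)) (oR.const_mul _),
    intervalIntegral.integral_add ((oP.const_mul _).add (oT.const_mul _)) (oQ.const_mul _),
    intervalIntegral.integral_add (oP.const_mul _) (oT.const_mul _)] at hmono4
  simp only [intervalIntegral.integral_const_mul] at hmono1 hmono4
  rw [← hJ] at hmono4
  have hnonneg : ∀ f : SF, 0 ≤ nSq f := fun f =>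
    intervalIntegral.integral_nonneg zero_le_one fun x _ =>
      intervalIntegral.integral_nonneg zero_le_one fun y _ => sq_nonneg _
  have hP := mul_nonneg (sq_nonneg δ) (hnonneg (pdx u))
  have hT := mul_nonneg (sq_nonneg δ) (hnonneg (pdy v))
  have hE := hnonneg (fun x y => pdy u x y + δ^2 * pdx v x y)
  simp only [nSq] at hP hT hE ⊢
  linarith
end
end

section
/- If f is a sufficiently smooth function on Ω with f(x,0) = 0 for all x, then ‖f‖_{L^∞(Ω)} ≲ ‖f_y‖ + ‖f_{xy}‖, with implicit constant independent of f. -/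
open MeasureTheory Real

noncomputable section

/-- The horizontal partial derivative of a smooth function is smooth. -/
lemma contDiff_pdx {f : SF} (hf : ∀ n : ℕ, ContDiff ℝ n (fun q : ℝ × ℝ => f q.1 q.2)) (n : ℕ) :
    ContDiff ℝ n (fun q : ℝ × ℝ => pdx f q.1 q.2) := by
  have key : (fun q : ℝ × ℝ => pdx f q.1 q.2) =
      fun q => fderiv ℝ (fun q : ℝ × ℝ => f q.1 q.2) q (1, 0) := by
    funext q
    have h1 := ((hf 1).differentiable (by simp) q).hasFDerivAt
    have h2 : HasDerivAt (fun s : ℝ => (s, q.2)) ((1 : ℝ), (0 : ℝ)) q.1 :=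
      (hasDerivAt_id _).prodMk (hasDerivAt_const _ _)
    exact (h1.comp_hasDerivAt q.1 h2).deriv
  rw [key]
  exact ((hf (n + 1)).fderiv_right (by simp)).clm_apply contDiff_const

/-- The vertical partial derivative of a smooth function is smooth. -/
lemma contDiff_pdy {f : SF} (hf : ∀ n : ℕ, ContDiff ℝ n (fun q : ℝ × ℝ => f q.1 q.2)) (n : ℕ) :
    ContDiff ℝ n (fun q : ℝ × ℝ => pdy f q.1 q.2) := by
  have key : (fun q : ℝ × ℝ => pdy f q.1 q.2) =
      fun q => fderiv ℝ (fun q : ℝ × ℝ => f q.1 q.2) q (0, 1) := by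
    funext q
    have h1 := ((hf 1).differentiable (by simp) q).hasFDerivAt
    have h2 : HasDerivAt (fun s : ℝ => (q.1, s)) ((0 : ℝ), (1 : ℝ)) q.2 :=
      (hasDerivAt_const _ _).prodMk (hasDerivAt_id _)
    exact (h1.comp_hasDerivAt q.2 h2).deriv
  rw [key]
  exact ((hf (n + 1)).fderiv_right (by simp)).clm_apply contDiff_const

/-- Cauchy–Schwarz on the unit interval, against the constant function `1`. -/
lemma sq_integral_le_integral_sq {v : ℝ → ℝ} (hv : Continuous v) :
    (∫ x in (0:ℝ)..1, v x) ^ 2 ≤ ∫ x in (0:ℝ)..1, (v x) ^ 2 := by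
  set A := ∫ x in (0:ℝ)..1, v x with hA
  have h0 : 0 ≤ ∫ x in (0:ℝ)..1, (v x - A) ^ 2 :=
    intervalIntegral.integral_nonneg zero_le_one fun x _ => sq_nonneg _
  have h1 : ∫ x in (0:ℝ)..1, (v x - A) ^ 2 =
      (∫ x in (0:ℝ)..1, (v x) ^ 2) - 2 * A * A + A ^ 2 := by
    have : ∀ x, (v x - A) ^ 2 = (v x) ^ 2 - 2 * A * v x + A ^ 2 := fun x => by ring
    simp only [this]
    rw [intervalIntegral.integral_add, intervalIntegral.integral_sub,
      intervalIntegral.integral_const_mul, ← hA]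
    · simp
    all_goals exact Continuous.intervalIntegrable (by fun_prop) _ _
  nlinarith

/-- On `Ω`, which has unit area, the `L¹` norm is at most the `L²` norm. -/
lemma integral_integral_abs_le_sqrt_nSq {u : SF} (hu : Continuous fun q : ℝ × ℝ => u q.1 q.2) :
    ∫ x in (0:ℝ)..1, ∫ y in (0:ℝ)..1, |u x y| ≤ √(nSq u) := by
  have hc1 : Continuous fun x => ∫ y in (0:ℝ)..1, |u x y| :=
    intervalIntegral.continuous_parametric_intervalIntegral_of_continuous'
      (f := fun x y => |u x y|) hu.abs 0 1
  have husq : Continuous fun q : ℝ × ℝ => (u q.1 q.2) ^ 2 := by fun_prop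
  have hc2 : Continuous fun x => ∫ y in (0:ℝ)..1, (u x y) ^ 2 :=
    intervalIntegral.continuous_parametric_intervalIntegral_of_continuous'
      (f := fun x y => (u x y) ^ 2) husq 0 1
  refine Real.le_sqrt_of_sq_le ((sq_integral_le_integral_sq hc1).trans ?_)
  refine intervalIntegral.integral_mono_on zero_le_one ((hc1.pow 2).intervalIntegrable _ _)
    (hc2.intervalIntegrable _ _) fun x _ => ?_
  have hx : Continuous fun y => |u x y| :=
    (hu.comp (continuous_const.prodMk continuous_id)).abs
  simpa only [sq_abs] using sq_integral_le_integral_sq hx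

/-- A `C¹` function on the unit interval varies by at most the `L¹` norm of its derivative. -/
lemma abs_le_abs_add_integral_abs_deriv {v : ℝ → ℝ} (hv : ContDiff ℝ 1 v) {x s : ℝ}
    (hx : x ∈ Set.Icc (0:ℝ) 1) (hs : s ∈ Set.Icc (0:ℝ) 1) :
    |v x| ≤ |v s| + ∫ t in (0:ℝ)..1, |deriv v t| := by
  have hc : Continuous (deriv v) := hv.continuous_deriv le_rfl
  have h1 : ∫ t in s..x, deriv v t = v x - v s :=
    intervalIntegral.integral_deriv_eq_sub (fun t _ => hv.differentiable (by simp) t)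
      (hc.intervalIntegrable _ _)
  have h2 : |v x - v s| ≤ ∫ t in (0:ℝ)..1, |deriv v t| := by
    rw [← h1, ← Real.norm_eq_abs, intervalIntegral.integral_of_le zero_le_one]
    refine intervalIntegral.norm_integral_le_integral_norm_uIoc.trans ?_
    refine setIntegral_mono_set ?_ (Filter.Eventually.of_forall fun t => abs_nonneg _) ?_
    · exact (intervalIntegrable_iff_integrableOn_Ioc_of_le zero_le_one).1
        (hc.abs.intervalIntegrable _ _)
    · exact (Set.Ioc_subset_Ioc (le_min hs.1 hx.1) (max_le hs.2 hx.2)).eventuallyLE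
  linarith [abs_sub_abs_le_abs_sub (v x) (v s)]

/-- The pointwise bound by `L¹` norms, for `x` in a period cell. -/
lemma abs_le_integral_abs_pdy_add {f : SF}
    (hf : ∀ n : ℕ, ContDiff ℝ n (fun q : ℝ × ℝ => f q.1 q.2)) (h0 : ∀ x : ℝ, f x 0 = 0)
    {x y : ℝ} (hx : x ∈ Set.Icc (0:ℝ) 1) (hy : y ∈ Set.Icc (0:ℝ) 1) :
    |f x y| ≤ (∫ s in (0:ℝ)..1, ∫ z in (0:ℝ)..1, |pdy f s z|) +
      ∫ s in (0:ℝ)..1, ∫ z in (0:ℝ)..1, |pdx (pdy f) s z| := by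
  have hg := contDiff_pdy hf
  have hgc := (hg 0).continuous
  have hhc := (contDiff_pdx hg 0).continuous
  have hgx : ∀ s, Continuous fun z => |pdy f s z| := fun s =>
    (hgc.comp (continuous_const.prodMk continuous_id)).abs
  have hG : Continuous fun s => ∫ z in (0:ℝ)..1, |pdy f s z| :=
    intervalIntegral.continuous_parametric_intervalIntegral_of_continuous'
      (f := fun s z => |pdy f s z|) hgc.abs 0 1
  have hH : Continuous fun z => ∫ t in (0:ℝ)..1, |pdx (pdy f) t z| :=
    intervalIntegral.continuous_parametric_intervalIntegral_of_continuous'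
      (f := fun z t => |pdx (pdy f) t z|) (hhc.comp continuous_swap).abs 0 1
  have hswap : (∫ s in (0:ℝ)..1, ∫ z in (0:ℝ)..1, |pdx (pdy f) s z|) =
      ∫ z in (0:ℝ)..1, ∫ s in (0:ℝ)..1, |pdx (pdy f) s z| :=
    intervalIntegral_intervalIntegral_swap (F := fun s z => |pdx (pdy f) s z|)
      ((hhc.abs.continuousOn.integrableOn_compact (isCompact_uIcc.prod isCompact_uIcc)).mono_set
        (Set.prod_mono Set.uIoc_subset_uIcc Set.uIoc_subset_uIcc))
  have hvert : |f x y| ≤ ∫ z in (0:ℝ)..1, |pdy f x z| := by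
    have hfx : ContDiff ℝ 1 (f x) := (hf 1).comp (contDiff_const.prodMk contDiff_id)
    have := abs_le_abs_add_integral_abs_deriv hfx hy (Set.left_mem_Icc.2 zero_le_one)
    rwa [h0, abs_zero, zero_add] at this
  have hhor : ∀ s ∈ Set.Icc (0:ℝ) 1, |f x y| ≤ (∫ z in (0:ℝ)..1, |pdy f s z|) +
      ∫ z in (0:ℝ)..1, ∫ t in (0:ℝ)..1, |pdx (pdy f) t z| := by
    intro s hs
    rw [← intervalIntegral.integral_add ((hgx s).intervalIntegrable _ _)
      (hH.intervalIntegrable _ _)]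
    refine hvert.trans (intervalIntegral.integral_mono_on zero_le_one
      ((hgx x).intervalIntegrable _ _) (((hgx s).add hH).intervalIntegrable _ _) fun z _ => ?_)
    have hgz : ContDiff ℝ 1 (fun t => pdy f t z) := (hg 1).comp (contDiff_id.prodMk contDiff_const)
    exact abs_le_abs_add_integral_abs_deriv hgz hx hs
  have hint := intervalIntegral.integral_mono_on zero_le_one
    (intervalIntegrable_const (μ := volume))
    ((hG.intervalIntegrable _ _).add intervalIntegrable_const) hhor
  rw [intervalIntegral.integral_add (hG.intervalIntegrable _ _) intervalIntegrable_const] at hint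
  simpa [hswap] using hint

/-- **Lemma 5.1.** If `f` is sufficiently smooth on `Ω` and `f(x,0) = 0` for all `x`,
then `‖f‖_{L^∞(Ω)} ≲ ‖f_y‖ + ‖f_{xy}‖`, with implicit constant independent of `f`. -/
theorem linfty_bound_of_vanishing_on_bottom :
    ∃ C : ℝ, 0 < C ∧ ∀ f : SF, SmoothF f → (∀ x : ℝ, f x 0 = 0) →
      ∀ x : ℝ, ∀ y ∈ Set.Ioo (0:ℝ) 1,
        |f x y| ≤ C * (Real.sqrt (nSq (pdy f)) + Real.sqrt (nSq (pdx (pdy f)))) := by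
  refine ⟨1, one_pos, fun f hf h0 x y hy => ?_⟩
  have hper : f x y = f (Int.fract x) y := by
    have := (hf.2 y).sub_zsmul_eq (x := x) ⌊x⌋
    rw [zsmul_one] at this
    exact this.symm
  have hg := contDiff_pdy hf.1
  rw [hper, one_mul]
  exact (abs_le_integral_abs_pdy_add hf.1 h0 ⟨Int.fract_nonneg x, (Int.fract_lt_one x).le⟩
    (Set.Ioo_subset_Icc_self hy)).trans
    (add_le_add (integral_integral_abs_le_sqrt_nSq (hg 0).continuous)
      (integral_integral_abs_le_sqrt_nSq (contDiff_pdx hg 0).continuous))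
end
end

section
/- (Anisotropic product estimates.) For any integer k ≥ 0 and sufficiently smooth functions a, b, f on Ω: (i) ‖∂_x^k(a f)‖ ≲ ‖a‖_{L^∞} ‖∂_x^k f‖ + (‖∂_x^k a‖ + ‖∂_x^k a_y‖)(‖f‖ + ‖f_x‖); (ii) ‖∂_x^k(a b f)‖ ≲ ‖a‖_{L^∞} ‖b‖_{L^∞} ‖∂_x^k f‖ + ‖b‖_{L^∞}(‖∂_x^k a‖ + ‖∂_x^k a_y‖)(‖f‖ + ‖f_x‖) + ‖a‖_{L^∞}(‖∂_x^k b‖ + ‖∂_x^k b_y‖)(‖f‖ + ‖f_x‖). Implicit constants depend only on k. -/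
open MeasureTheory Real

noncomputable section

theorem exists_pow_mul_pow_mul_pow_le (i n m : ℕ) (hm : 1 ≤ m) {ε : ℝ} (hε : 0 < ε) :
    ∃ C : ℝ, 0 ≤ C ∧ ∀ S T R : ℝ, 0 ≤ S → 0 ≤ T → 0 ≤ R →
      S ^ i * T ^ n * R ^ m ≤
        ε * (S ^ (i + n + m) + T ^ (i + n + m)) + C * R ^ (i + n + m) := by
  set η := min ε 1 with hη
  have hη0 : 0 < η := lt_min hε one_pos
  have hη1 : η ≤ 1 := min_le_right _ _
  have hηε : η ≤ ε := min_le_left _ _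
  refine ⟨(1 / η) ^ (i + n + m), by positivity, fun S T R hS hT hR => ?_⟩
  set M := max S T with hM
  have hSM : S ≤ M := le_max_left _ _
  have hTM : T ≤ M := le_max_right _ _
  have hM0 : 0 ≤ M := hS.trans hSM
  have hMp : M ^ (i + n + m) ≤ S ^ (i + n + m) + T ^ (i + n + m) := by
    rcases max_choice S T with h | h <;> rw [hM, h] <;>
      linarith [pow_nonneg hS (i + n + m), pow_nonneg hT (i + n + m)]
  have h1 : S ^ i * T ^ n * R ^ m ≤ M ^ i * M ^ n * R ^ m := by gcongr
  rcases le_total R (η * M) with h | h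
  · have h2 : M ^ i * M ^ n * R ^ m ≤ η * M ^ (i + n + m) := by
      calc M ^ i * M ^ n * R ^ m ≤ M ^ i * M ^ n * (η * M) ^ m := by gcongr
        _ = η ^ m * M ^ (i + n + m) := by ring
        _ ≤ η * M ^ (i + n + m) := by
          gcongr
          exact pow_le_of_le_one hη0.le hη1 (by omega)
    have h3 : η * M ^ (i + n + m) ≤ ε * (S ^ (i + n + m) + T ^ (i + n + m)) := by gcongr
    have h4 : 0 ≤ (1 / η) ^ (i + n + m) * R ^ (i + n + m) := by positivity
    linarith
  · have h2 : M ≤ 1 / η * R := by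
      rw [one_div, ← div_eq_inv_mul, le_div_iff₀ hη0]; linarith
    have h3 : R ≤ 1 / η * R := by
      have : 1 ≤ 1 / η := by rwa [le_div_iff₀ hη0, one_mul]
      nlinarith
    have h4 : M ^ i * M ^ n * R ^ m ≤ (1 / η) ^ (i + n + m) * R ^ (i + n + m) := by
      calc M ^ i * M ^ n * R ^ m
          ≤ (1 / η * R) ^ i * (1 / η * R) ^ n * (1 / η * R) ^ m := by gcongr
        _ = _ := by rw [← mul_pow]; ring
    have h5 : 0 ≤ ε * (S ^ (i + n + m) + T ^ (i + n + m)) := by positivity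
    linarith

theorem hasDerivAt_abs_rpow_mul_self {q : ℝ} (hq : 0 < q) (x : ℝ) :
    HasDerivAt (fun s : ℝ => |s| ^ q * s) ((q + 1) * |x| ^ q) x := by
  have hc : Continuous fun s : ℝ => |s| ^ q := continuous_abs.rpow_const fun _ => Or.inr hq.le
  have hne : ∀ y : ℝ, y ≠ 0 →
      HasDerivAt (fun s : ℝ => |s| ^ q * s) ((q + 1) * |y| ^ q) y := by
    intro y hy
    have h := ((hasDerivAt_abs hy).rpow_const (p := q) (Or.inl (abs_ne_zero.2 hy))).mul
      (hasDerivAt_id y)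
    refine h.congr_deriv ?_
    have hy' : 0 < |y| := abs_pos.2 hy
    rw [Real.rpow_sub_one hy'.ne']
    have : (SignType.sign y : ℝ) * y = |y| := sign_mul_self y
    simp only [id]
    field_simp
    linear_combination (q) * this
  rcases eq_or_ne x 0 with rfl | hx
  · exact hasDerivAt_of_hasDerivAt_of_ne hne (hc.mul continuous_id).continuousAt
      (continuous_const.mul hc).continuousAt
  · exact hne x hx

theorem Function.Periodic.deriv_periodic {g : ℝ → ℝ} {c : ℝ} (hg : Function.Periodic g c) :
    Function.Periodic (deriv g) c := by
  intro x
  rw [← deriv_comp_add_const, funext hg]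

protected theorem SmoothP.contDiff_infty {g : ℝ → ℝ} (hg : SmoothP g) : ContDiff ℝ (⊤ : ℕ∞) g :=
  contDiff_infty.2 hg.1

protected theorem SmoothP.deriv {g : ℝ → ℝ} (hg : SmoothP g) : SmoothP (deriv g) :=
  ⟨contDiff_infty.1 (contDiff_infty_iff_deriv.1 hg.contDiff_infty).2, hg.2.deriv_periodic⟩

protected theorem SmoothP.iteratedDeriv {g : ℝ → ℝ} (hg : SmoothP g) (n : ℕ) :
    SmoothP (iteratedDeriv n g) := by
  induction n with
  | zero => simpa using hg
  | succ n ih => rw [iteratedDeriv_succ]; exact ih.deriv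

theorem SmoothP.continuous {g : ℝ → ℝ} (hg : SmoothP g) : Continuous g :=
  hg.contDiff_infty.continuous

theorem SmoothP.hasDerivAt {g : ℝ → ℝ} (hg : SmoothP g) (x : ℝ) :
    HasDerivAt g (deriv g x) x :=
  ((hg.1 1).differentiable (by norm_num) x).hasDerivAt

theorem SmoothP.mul {g h : ℝ → ℝ} (hg : SmoothP g) (hh : SmoothP h) :
    SmoothP (fun x => g x * h x) :=
  ⟨fun n => (hg.1 n).mul (hh.1 n), fun x => by simp only [hg.2 x, hh.2 x]⟩

theorem SmoothP.const_mul {g : ℝ → ℝ} (hg : SmoothP g) (c : ℝ) : SmoothP (fun x => c * g x) :=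
  ⟨fun n => contDiff_const.mul (hg.1 n), fun x => by simp only [hg.2 x]⟩

theorem SmoothP.integral_abs_deriv_rpow_le {w : ℝ → ℝ} (hw : SmoothP w) {q : ℝ} (hq : 0 < q) :
    ∫ x in (0:ℝ)..1, |deriv w x| ^ q * deriv w x ^ 2 ≤
      (q + 1) * ∫ x in (0:ℝ)..1,
        |w x| * |deriv w x| ^ q * |deriv (deriv w) x| := by
  have c0 := hw.continuous
  have c1 := hw.deriv.continuous
  have c2 := hw.deriv.deriv.continuous
  have cq : Continuous fun x => |deriv w x| ^ q :=
    c1.abs.rpow_const fun _ => Or.inr hq.le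
  have key : ∀ x, HasDerivAt (fun s => w s * (|deriv w s| ^ q * deriv w s))
      (deriv w x * (|deriv w x| ^ q * deriv w x) +
        w x * ((q + 1) * |deriv w x| ^ q * deriv (deriv w) x)) x := fun x =>
    (hw.hasDerivAt x).mul
      ((hasDerivAt_abs_rpow_mul_self hq (deriv w x)).comp x (hw.deriv.hasDerivAt x))
  have hI := intervalIntegral.integral_eq_sub_of_hasDerivAt (a := 0) (b := 1)
    (fun x _ => key x) (Continuous.intervalIntegrable (by fun_prop) _ _)
  have e0 : w 1 = w 0 := by simpa using hw.2 0
  have e1 : deriv w 1 = deriv w 0 := by simpa using hw.deriv.2 0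
  rw [e0, e1, sub_self, intervalIntegral.integral_add
    (Continuous.intervalIntegrable (by fun_prop) _ _)
    (Continuous.intervalIntegrable (by fun_prop) _ _)] at hI
  have hL : ∫ x in (0:ℝ)..1, |deriv w x| ^ q * deriv w x ^ 2 =
      ∫ x in (0:ℝ)..1,
        -(w x * ((q + 1) * |deriv w x| ^ q * deriv (deriv w) x)) := by
    rw [intervalIntegral.integral_neg, ← eq_neg_of_add_eq_zero_left hI]
    congr 1; ext x; ring
  rw [hL, ← intervalIntegral.integral_const_mul]
  refine intervalIntegral.integral_mono_on zero_le_one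
    (Continuous.intervalIntegrable (by fun_prop) _ _)
    (Continuous.intervalIntegrable (by fun_prop) _ _) fun x _ => ?_
  refine (neg_le_abs _).trans (le_of_eq ?_)
  rw [abs_mul, abs_mul, abs_mul, abs_of_nonneg (by positivity : 0 ≤ q + 1),
    abs_of_nonneg (by positivity : 0 ≤ |deriv w x| ^ q)]
  ring

/-- The homogeneous root `|u^{(j)}|^{1/j}`. -/
def derivRoot (j : ℕ) (u : ℝ → ℝ) (x : ℝ) : ℝ := |iteratedDeriv j u x| ^ (1 / (j : ℝ))

theorem derivRoot_nonneg (j : ℕ) (u : ℝ → ℝ) (x : ℝ) : 0 ≤ derivRoot j u x := by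
  unfold derivRoot; positivity

theorem derivRoot_rpow (j : ℕ) (hj : j ≠ 0) (u : ℝ → ℝ) (x : ℝ) (s : ℝ) :
    derivRoot j u x ^ (j * s) = |iteratedDeriv j u x| ^ s := by
  have : (j : ℝ) ≠ 0 := by exact_mod_cast hj
  rw [derivRoot, ← Real.rpow_mul (abs_nonneg _)]
  congr 1; field_simp

theorem derivRoot_pow (j : ℕ) (hj : j ≠ 0) (u : ℝ → ℝ) (x : ℝ) :
    derivRoot j u x ^ j = |iteratedDeriv j u x| := by
  have := derivRoot_rpow j hj u x 1
  rwa [mul_one, Real.rpow_one, Real.rpow_natCast] at this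

theorem SmoothP.continuous_derivRoot {u : ℝ → ℝ} (hu : SmoothP u) (j : ℕ) :
    Continuous (derivRoot j u) :=
  (hu.iteratedDeriv j).continuous.abs.rpow_const fun _ => Or.inr (by positivity)

theorem SmoothP.integral_derivRoot_pow_le {k i : ℕ} (hik : i + 1 < k) {ε : ℝ} (hε : 0 < ε) :
    ∃ C : ℝ, 0 ≤ C ∧ ∀ u S : ℝ → ℝ, SmoothP u → Continuous S → (∀ x, 0 ≤ S x) →
      (∀ x, |iteratedDeriv i u x| ≤ S x ^ i) →
      ∫ x in (0:ℝ)..1, derivRoot (i + 1) u x ^ (2 * k) ≤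
        ε * ((∫ x in (0:ℝ)..1, S x ^ (2 * k)) +
            ∫ x in (0:ℝ)..1, derivRoot (i + 1) u x ^ (2 * k)) +
          C * ∫ x in (0:ℝ)..1, derivRoot (i + 2) u x ^ (2 * k) := by
  obtain ⟨n, hn⟩ : ∃ n, 2 * k = i + n + (i + 2) ∧ 0 < n := ⟨2 * k - 2 * (i + 1), by omega⟩
  set q : ℝ := n / (i + 1) with hqdef
  have hq : 0 < q := by
    have : (0:ℝ) < n := by exact_mod_cast hn.2
    positivity
  have hqn : ((i + 1 : ℕ) : ℝ) * q = n := by rw [hqdef]; push_cast; field_simp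
  obtain ⟨C, hC, hY⟩ := exists_pow_mul_pow_mul_pow_le i n (i + 2) (by omega)
    (div_pos hε (by positivity : 0 < q + 1))
  refine ⟨(q + 1) * C, by positivity, fun u S hu hS hS0 hSi => ?_⟩
  have cR := hu.continuous_derivRoot (i + 1)
  have cR' := hu.continuous_derivRoot (i + 2)
  have hq' : ∀ x, |iteratedDeriv (i + 1) u x| ^ q = derivRoot (i + 1) u x ^ n := by
    intro x
    rw [← derivRoot_rpow (i + 1) (by omega), hqn, Real.rpow_natCast]
  have h1 := (hu.iteratedDeriv i).integral_abs_deriv_rpow_le hq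
  simp only [← iteratedDeriv_succ] at h1
  have hL : ∀ x, |iteratedDeriv (i + 1) u x| ^ q * iteratedDeriv (i + 1) u x ^ 2 =
      derivRoot (i + 1) u x ^ (2 * k) := by
    intro x
    rw [hq', ← sq_abs, ← derivRoot_pow (i + 1) (by omega), ← pow_mul, ← pow_add]
    congr 1; omega
  simp only [hL] at h1
  simp only [hq'] at h1
  have h2 : ∫ x in (0:ℝ)..1, |iteratedDeriv i u x| * derivRoot (i + 1) u x ^ n *
        |iteratedDeriv (i + 1 + 1) u x| ≤
      ∫ x in (0:ℝ)..1, (ε / (q + 1) * (S x ^ (2 * k) + derivRoot (i + 1) u x ^ (2 * k)) +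
        C * derivRoot (i + 2) u x ^ (2 * k)) := by
    have c0 := (hu.iteratedDeriv i).continuous
    have c2 := (hu.iteratedDeriv (i + 1 + 1)).continuous
    refine intervalIntegral.integral_mono_on zero_le_one
      (Continuous.intervalIntegrable (by fun_prop) _ _)
      (Continuous.intervalIntegrable (by fun_prop) _ _) fun x _ => ?_
    have h3 := hY (S x) _ _ (hS0 x) (derivRoot_nonneg (i + 1) u x) (derivRoot_nonneg (i + 2) u x)
    rw [← hn.1, derivRoot_pow (i + 2) (by omega)] at h3
    refine le_trans ?_ h3
    have := derivRoot_nonneg (i + 1) u x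
    gcongr
    exact hSi x
  rw [intervalIntegral.integral_add (Continuous.intervalIntegrable (by fun_prop) _ _)
      (Continuous.intervalIntegrable (by fun_prop) _ _),
    intervalIntegral.integral_const_mul, intervalIntegral.integral_const_mul,
    intervalIntegral.integral_add (Continuous.intervalIntegrable (by fun_prop) _ _)
      (Continuous.intervalIntegrable (by fun_prop) _ _)] at h2
  refine h1.trans ((mul_le_mul_of_nonneg_left h2 (by positivity)).trans (le_of_eq ?_))
  field_simp

theorem SmoothP.integral_derivRoot_pow_le_succ {k i : ℕ} (hik : i + 1 < k) :
    ∃ C : ℝ, 0 ≤ C ∧ ∀ u : ℝ → ℝ, SmoothP u → (∀ x, |u x| ≤ 1) →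
      ∫ x in (0:ℝ)..1, derivRoot (i + 1) u x ^ (2 * k) ≤
        C * ∫ x in (0:ℝ)..1, derivRoot (i + 2) u x ^ (2 * k) := by
  induction i with
  | zero =>
    obtain ⟨C, hC, h⟩ := SmoothP.integral_derivRoot_pow_le hik (ε := 1 / 2) (by norm_num)
    refine ⟨2 * C, by positivity, fun u hu hu1 => ?_⟩
    have h0 := h u (fun _ => 0) hu continuous_const (fun _ => le_rfl) (by simpa using hu1)
    rw [zero_pow (by omega : 2 * k ≠ 0), intervalIntegral.integral_zero] at h0
    linarith
  | succ i ih =>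
    obtain ⟨C', hC', h'⟩ := ih (by omega)
    obtain ⟨C, hC, h⟩ := SmoothP.integral_derivRoot_pow_le hik (ε := 1 / (2 * (C' + 1)))
      (by positivity)
    refine ⟨2 * C, by positivity, fun u hu hu1 => ?_⟩
    have h0 := h u (derivRoot (i + 1) u) hu (hu.continuous_derivRoot _) (derivRoot_nonneg _ _)
      (fun x => (derivRoot_pow (i + 1) (by omega) u x).ge)
    have h1 := h' u hu hu1
    set X := ∫ x in (0:ℝ)..1, derivRoot (i + 1) u x ^ (2 * k)
    set Y := ∫ x in (0:ℝ)..1, derivRoot (i + 1 + 1) u x ^ (2 * k)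
    have h2 : 1 / (2 * (C' + 1)) * (X + Y) ≤ 1 / (2 * (C' + 1)) * ((C' + 1) * Y) := by
      gcongr; linarith
    have h3 : 1 / (2 * (C' + 1)) * ((C' + 1) * Y) = Y / 2 := by field_simp
    linarith

theorem SmoothP.integral_derivRoot_pow_le_top {k j : ℕ} (hj : 1 ≤ j) (hjk : j ≤ k) :
    ∃ C : ℝ, 0 ≤ C ∧ ∀ u : ℝ → ℝ, SmoothP u → (∀ x, |u x| ≤ 1) →
      ∫ x in (0:ℝ)..1, derivRoot j u x ^ (2 * k) ≤
        C * ∫ x in (0:ℝ)..1, iteratedDeriv k u x ^ 2 := by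
  induction hjk using Nat.decreasingInduction with
  | self =>
    refine ⟨1, zero_le_one, fun u hu hu1 => le_of_eq ?_⟩
    rw [one_mul]
    congr 1; ext x
    rw [mul_comm, pow_mul, derivRoot_pow k (by omega), sq_abs]
  | of_succ j hjk ih =>
    obtain ⟨C, hC, h⟩ := ih (by omega)
    obtain ⟨i, rfl⟩ : ∃ i, j = i + 1 := ⟨j - 1, by omega⟩
    obtain ⟨C', hC', h'⟩ := SmoothP.integral_derivRoot_pow_le_succ hjk
    refine ⟨C' * C, by positivity, fun u hu hu1 => ?_⟩
    rw [mul_assoc]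
    exact (h' u hu hu1).trans (mul_le_mul_of_nonneg_left (h u hu hu1) hC')

/-- Each Leibniz term of a product of functions bounded by `1`. -/
theorem SmoothP.integral_iteratedDeriv_mul_sq_le_of_abs_le_one {k i : ℕ} (hik : i ≤ k) :
    ∃ C : ℝ, 0 ≤ C ∧ ∀ u v : ℝ → ℝ, SmoothP u → SmoothP v → (∀ x, |u x| ≤ 1) →
      (∀ x, |v x| ≤ 1) →
      ∫ x in (0:ℝ)..1, (iteratedDeriv i u x * iteratedDeriv (k - i) v x) ^ 2 ≤
        C * ((∫ x in (0:ℝ)..1, iteratedDeriv k v x ^ 2) +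
          ∫ x in (0:ℝ)..1, iteratedDeriv k u x ^ 2) := by
  have key : ∀ w z : ℝ → ℝ, SmoothP w → SmoothP z → (∀ x, |w x| ≤ 1) →
      ∫ x in (0:ℝ)..1, (w x * iteratedDeriv k z x) ^ 2 ≤
        ∫ x in (0:ℝ)..1, iteratedDeriv k z x ^ 2 := by
    intro w z hw hz hw1
    have c1 := hw.continuous
    have c2 := (hz.iteratedDeriv k).continuous
    refine intervalIntegral.integral_mono_on zero_le_one
      (Continuous.intervalIntegrable (by fun_prop) _ _)
      (Continuous.intervalIntegrable (by fun_prop) _ _) fun x _ => ?_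
    rw [mul_pow]
    exact mul_le_of_le_one_left (sq_nonneg _) ((sq_le_one_iff_abs_le_one _).2 (hw1 x))
  have hnn : ∀ w : ℝ → ℝ, 0 ≤ ∫ x in (0:ℝ)..1, iteratedDeriv k w x ^ 2 := fun w =>
    intervalIntegral.integral_nonneg zero_le_one fun _ _ => sq_nonneg _
  rcases Nat.eq_zero_or_pos i with rfl | hi
  · refine ⟨1, zero_le_one, fun u v hu hv hu1 hv1 => ?_⟩
    have := key u v hu hv hu1
    simp only [iteratedDeriv_zero, Nat.sub_zero]
    linarith [hnn u]
  rcases hik.eq_or_lt with rfl | hlt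
  · refine ⟨1, zero_le_one, fun u v hu hv hu1 hv1 => ?_⟩
    have := key v u hv hu hv1
    simp only [iteratedDeriv_zero, Nat.sub_self, mul_comm _ (v _)]
    linarith [hnn v]
  obtain ⟨C, hC, h⟩ := SmoothP.integral_derivRoot_pow_le_top hi hik
  obtain ⟨C', hC', h'⟩ := SmoothP.integral_derivRoot_pow_le_top (k := k) (j := k - i)
    (by omega) (by omega)
  refine ⟨C + C', by positivity, fun u v hu hv hu1 hv1 => ?_⟩
  have c1 := (hu.iteratedDeriv i).continuous
  have c2 := (hv.iteratedDeriv (k - i)).continuous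
  have d1 := hu.continuous_derivRoot i
  have d2 := hv.continuous_derivRoot (k - i)
  have h1 : ∫ x in (0:ℝ)..1, (iteratedDeriv i u x * iteratedDeriv (k - i) v x) ^ 2 ≤
      ∫ x in (0:ℝ)..1, (derivRoot i u x ^ (2 * k) + derivRoot (k - i) v x ^ (2 * k)) := by
    refine intervalIntegral.integral_mono_on zero_le_one
      (Continuous.intervalIntegrable (by fun_prop) _ _)
      (Continuous.intervalIntegrable (by fun_prop) _ _) fun x _ => ?_
    have hS := derivRoot_nonneg i u x
    have hT := derivRoot_nonneg (k - i) v x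
    have e : (iteratedDeriv i u x * iteratedDeriv (k - i) v x) ^ 2 =
        derivRoot i u x ^ (2 * i) * derivRoot (k - i) v x ^ (2 * (k - i)) := by
      rw [mul_comm 2 i, mul_comm 2 (k - i), pow_mul, pow_mul, derivRoot_pow i (by omega),
        derivRoot_pow (k - i) (by omega), sq_abs, sq_abs, mul_pow]
    rw [e]
    set S := derivRoot i u x
    set T := derivRoot (k - i) v x
    have hM : max S T ^ (2 * k) ≤ S ^ (2 * k) + T ^ (2 * k) := by
      rcases max_choice S T with h | h <;> rw [h] <;>
        linarith [pow_nonneg hS (2 * k), pow_nonneg hT (2 * k)]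
    refine le_trans ?_ hM
    calc S ^ (2 * i) * T ^ (2 * (k - i)) ≤ max S T ^ (2 * i) * max S T ^ (2 * (k - i)) := by
          gcongr
          exacts [le_max_left _ _, le_max_right _ _]
      _ = max S T ^ (2 * k) := by rw [← pow_add]; congr 1; omega
  rw [intervalIntegral.integral_add (Continuous.intervalIntegrable (by fun_prop) _ _)
      (Continuous.intervalIntegrable (by fun_prop) _ _)] at h1
  have h2 := h u hu hu1
  have h3 := h' v hv hv1
  nlinarith [mul_nonneg hC (hnn v), mul_nonneg hC' (hnn u)]

theorem SmoothP.integral_iteratedDeriv_mul_sq_le_of_le_one (k : ℕ) :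
    ∃ C : ℝ, 0 ≤ C ∧ ∀ u v : ℝ → ℝ, SmoothP u → SmoothP v → (∀ x, |u x| ≤ 1) →
      (∀ x, |v x| ≤ 1) →
      ∫ x in (0:ℝ)..1, iteratedDeriv k (fun s => u s * v s) x ^ 2 ≤
        C * ((∫ x in (0:ℝ)..1, iteratedDeriv k v x ^ 2) +
          ∫ x in (0:ℝ)..1, iteratedDeriv k u x ^ 2) := by
  have hterm : ∀ i : ℕ, ∃ C : ℝ, i ≤ k → (0 ≤ C ∧ ∀ u v : ℝ → ℝ, SmoothP u → SmoothP v →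
      (∀ x, |u x| ≤ 1) → (∀ x, |v x| ≤ 1) →
      ∫ x in (0:ℝ)..1, (iteratedDeriv i u x * iteratedDeriv (k - i) v x) ^ 2 ≤
        C * ((∫ x in (0:ℝ)..1, iteratedDeriv k v x ^ 2) +
          ∫ x in (0:ℝ)..1, iteratedDeriv k u x ^ 2)) := by
    intro i
    by_cases hik : i ≤ k
    · obtain ⟨C, hC⟩ := SmoothP.integral_iteratedDeriv_mul_sq_le_of_abs_le_one hik
      exact ⟨C, fun _ => hC⟩
    · exact ⟨0, fun h => absurd h hik⟩
  choose C hC using hterm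
  have hC0 : ∀ i ∈ Finset.range (k + 1), 0 ≤ C i := fun i hi =>
    (hC i (Nat.lt_succ_iff.1 (Finset.mem_range.1 hi))).1
  refine ⟨(k + 1) * ∑ i ∈ Finset.range (k + 1), (k.choose i : ℝ) ^ 2 * C i,
    mul_nonneg (by positivity) (Finset.sum_nonneg fun i hi => mul_nonneg (sq_nonneg _) (hC0 i hi)),
    fun u v hu hv hu1 hv1 => ?_⟩
  have cu := fun i => (hu.iteratedDeriv i).continuous
  have cv := fun i => (hv.iteratedDeriv i).continuous
  have cuv := ((hu.mul hv).iteratedDeriv k).continuous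
  set E := (∫ x in (0:ℝ)..1, iteratedDeriv k v x ^ 2) +
          ∫ x in (0:ℝ)..1, iteratedDeriv k u x ^ 2 with hE
  have h1 : ∫ x in (0:ℝ)..1, iteratedDeriv k (fun s => u s * v s) x ^ 2 ≤
      ∫ x in (0:ℝ)..1, (k + 1) * ∑ i ∈ Finset.range (k + 1),
        (k.choose i : ℝ) ^ 2 * (iteratedDeriv i u x * iteratedDeriv (k - i) v x) ^ 2 := by
    refine intervalIntegral.integral_mono_on zero_le_one
      (Continuous.intervalIntegrable (by fun_prop) _ _)
      (Continuous.intervalIntegrable (by fun_prop) _ _) fun x _ => ?_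
    rw [iteratedDeriv_fun_mul (hu.1 k).contDiffAt (hv.1 k).contDiffAt]
    refine sq_sum_le_card_mul_sum_sq.trans (le_of_eq ?_)
    rw [Finset.card_range]
    push_cast
    congr 1
    exact Finset.sum_congr rfl fun i _ => by ring
  refine h1.trans ?_
  rw [intervalIntegral.integral_const_mul, intervalIntegral.integral_finsetSum
    (fun i _ => Continuous.intervalIntegrable (by fun_prop) _ _), mul_assoc, Finset.sum_mul]
  gcongr with i hi
  rw [intervalIntegral.integral_const_mul, mul_assoc]
  gcongr
  exact (hC i (Nat.lt_succ_iff.1 (Finset.mem_range.1 hi))).2 u v hu hv hu1 hv1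

/-- Moser's product estimate for `1`-periodic functions of one variable. -/
theorem SmoothP.integral_iteratedDeriv_mul_sq_le (k : ℕ) :
    ∃ C : ℝ, 0 ≤ C ∧ ∀ (u v : ℝ → ℝ) (A B : ℝ), SmoothP u → SmoothP v → (∀ x, |u x| ≤ A) →
      (∀ x, |v x| ≤ B) →
      ∫ x in (0:ℝ)..1, iteratedDeriv k (fun s => u s * v s) x ^ 2 ≤
        C * (A ^ 2 * (∫ x in (0:ℝ)..1, iteratedDeriv k v x ^ 2) +
          B ^ 2 * ∫ x in (0:ℝ)..1, iteratedDeriv k u x ^ 2) := by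
  obtain ⟨C, hC, h⟩ := SmoothP.integral_iteratedDeriv_mul_sq_le_of_le_one k
  refine ⟨C, hC, fun u v A B hu hv huA hvB => ?_⟩
  have hnn : ∀ w : ℝ → ℝ, 0 ≤ ∫ x in (0:ℝ)..1, iteratedDeriv k w x ^ 2 := fun w =>
    intervalIntegral.integral_nonneg zero_le_one fun _ _ => sq_nonneg _
  have hA0 : 0 ≤ A := (abs_nonneg _).trans (huA 0)
  have hB0 : 0 ≤ B := (abs_nonneg _).trans (hvB 0)
  have hrhs : 0 ≤ C * (A ^ 2 * (∫ x in (0:ℝ)..1, iteratedDeriv k v x ^ 2) +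
          B ^ 2 * ∫ x in (0:ℝ)..1, iteratedDeriv k u x ^ 2) :=
    mul_nonneg hC (add_nonneg (mul_nonneg (sq_nonneg _) (hnn v))
      (mul_nonneg (sq_nonneg _) (hnn u)))
  by_cases hz : A = 0 ∨ B = 0
  · have h0 : (fun s => u s * v s) = fun _ => 0 := by
      funext s
      rcases hz with rfl | rfl
      · rw [abs_nonpos_iff.1 (huA s), zero_mul]
      · rw [abs_nonpos_iff.1 (hvB s), mul_zero]
    have h0' : iteratedDeriv k (fun _ : ℝ => (0:ℝ)) = fun _ => 0 := by
      funext x; simp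
    rw [h0, h0']
    simpa using hrhs
  · obtain ⟨hA, hB⟩ := not_or.1 hz
    have hA' : 0 < A := hA0.lt_of_ne' hA
    have hB' : 0 < B := hB0.lt_of_ne' hB
    have habs : ∀ (w : ℝ → ℝ) (D : ℝ), 0 < D → (∀ x, |w x| ≤ D) → ∀ x, |D⁻¹ * w x| ≤ 1 := by
      intro w D hD hw x
      rw [abs_mul, abs_of_pos (inv_pos.2 hD), ← div_eq_inv_mul]
      exact (div_le_one hD).2 (hw x)
    have h1 := h _ _ (hu.const_mul A⁻¹) (hv.const_mul B⁻¹) (habs u A hA' huA) (habs v B hB' hvB)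
    have e : (fun s => A⁻¹ * u s * (B⁻¹ * v s)) = fun s => (A⁻¹ * B⁻¹) * (u s * v s) := by
      funext s; ring
    rw [e] at h1
    simp only [iteratedDeriv_const_mul_field, mul_pow, intervalIntegral.integral_const_mul] at h1
    have h2 := mul_le_mul_of_nonneg_left h1 (by positivity : 0 ≤ A ^ 2 * B ^ 2)
    field_simp at h2
    linarith

theorem sq_le_integral_sq_add {g g' : ℝ → ℝ} (hg : ∀ x, HasDerivAt g (g' x) x)
    (hg' : Continuous g') {x : ℝ} (hx : x ∈ Set.Icc (0:ℝ) 1) :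
    g x ^ 2 ≤ 2 * ((∫ t in (0:ℝ)..1, g t ^ 2) + ∫ t in (0:ℝ)..1, g' t ^ 2) := by
  have cg : Continuous g := continuous_iff_continuousAt.2 fun x => (hg x).continuousAt
  set K := ∫ s in (0:ℝ)..1, (g s ^ 2 + g' s ^ 2) with hK
  have h1 : ∀ t ∈ Set.Icc (0:ℝ) 1, g x ^ 2 ≤ g t ^ 2 + K := by
    intro t ht
    have hI := intervalIntegral.integral_eq_sub_of_hasDerivAt (a := t) (b := x)
      (fun s _ => (hg s).pow 2) (Continuous.intervalIntegrable (by fun_prop) _ _)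
    have h2 : ‖∫ s in t..x, ((2:ℕ) * g s ^ (2 - 1) * g' s)‖ ≤
        |∫ s in t..x, (g s ^ 2 + g' s ^ 2)| := by
      refine intervalIntegral.norm_integral_le_abs_of_norm_le
        (Filter.Eventually.of_forall fun s => ?_)
        (Continuous.intervalIntegrable (by fun_prop) _ _)
      rw [Real.norm_eq_abs, abs_le]
      norm_num
      constructor <;> nlinarith [sq_nonneg (g s + g' s), sq_nonneg (g s - g' s)]
    have hnn : ∀ s, 0 ≤ g s ^ 2 + g' s ^ 2 := fun s => by positivity
    have h3 : |∫ s in t..x, (g s ^ 2 + g' s ^ 2)| ≤ K := by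
      have hK0 : 0 ≤ K := intervalIntegral.integral_nonneg zero_le_one fun s _ => hnn s
      rw [← abs_of_nonneg hK0]
      refine intervalIntegral.abs_integral_mono_interval ?_ (Filter.Eventually.of_forall hnn)
        (Continuous.intervalIntegrable (by fun_prop) _ _)
      rw [Set.uIoc, Set.uIoc_of_le zero_le_one]
      exact Set.Ioc_subset_Ioc (le_min ht.1 hx.1) (max_le ht.2 hx.2)
    have h4 := (Real.le_norm_self _).trans (h2.trans h3)
    simp only [Pi.pow_apply] at hI
    linarith
  have h2 : ∫ t in (0:ℝ)..1, g x ^ 2 ≤ ∫ t in (0:ℝ)..1, (g t ^ 2 + K) :=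
    intervalIntegral.integral_mono_on zero_le_one
      (Continuous.intervalIntegrable (by fun_prop) _ _)
      (Continuous.intervalIntegrable (by fun_prop) _ _) h1
  rw [intervalIntegral.integral_add (Continuous.intervalIntegrable (by fun_prop) _ _)
    (Continuous.intervalIntegrable (by fun_prop) _ _)] at h2
  rw [intervalIntegral.integral_add (Continuous.intervalIntegrable (by fun_prop) _ _)
    (Continuous.intervalIntegrable (by fun_prop) _ _)] at hK
  have : 0 ≤ ∫ t in (0:ℝ)..1, g' t ^ 2 :=
    intervalIntegral.integral_nonneg zero_le_one fun _ _ => sq_nonneg _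
  simp only [intervalIntegral.integral_const, sub_zero, one_smul] at h2
  linarith

protected theorem SmoothF.contDiff_infty {f : SF} (hf : SmoothF f) :
    ContDiff ℝ (⊤ : ℕ∞) (fun q : ℝ × ℝ => f q.1 q.2) :=
  contDiff_infty.2 hf.1

theorem SmoothF.continuous_uncurry {f : SF} (hf : SmoothF f) :
    Continuous (fun q : ℝ × ℝ => f q.1 q.2) :=
  hf.contDiff_infty.continuous

theorem SmoothF.smoothP {f : SF} (hf : SmoothF f) (y : ℝ) : SmoothP fun x => f x y :=
  ⟨fun n => (hf.1 n).comp (contDiff_id.prodMk contDiff_const), hf.2 y⟩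

theorem SmoothF.mul {f g : SF} (hf : SmoothF f) (hg : SmoothF g) :
    SmoothF fun x y => f x y * g x y :=
  ⟨fun n => (hf.1 n).mul (hg.1 n), fun y x => by
    have h1 := hf.2 y x
    have h2 := hg.2 y x
    simp only at h1 h2 ⊢
    rw [h1, h2]⟩

theorem SmoothF.hasDerivAt_fst {f : SF} (hf : SmoothF f) (x y : ℝ) :
    HasDerivAt (fun s => f s y) (fderiv ℝ (fun q : ℝ × ℝ => f q.1 q.2) (x, y) (1, 0)) x :=
  ((hf.1 1).differentiable (by norm_num) (x, y)).hasFDerivAt.comp_hasDerivAt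
    (f := fun s : ℝ => (s, y)) x ((hasDerivAt_id x).prodMk (hasDerivAt_const x y))

theorem SmoothF.hasDerivAt_snd {f : SF} (hf : SmoothF f) (x y : ℝ) :
    HasDerivAt (fun s => f x s) (fderiv ℝ (fun q : ℝ × ℝ => f q.1 q.2) (x, y) (0, 1)) y :=
  ((hf.1 1).differentiable (by norm_num) (x, y)).hasFDerivAt.comp_hasDerivAt
    (f := fun s : ℝ => (x, s)) y ((hasDerivAt_const y x).prodMk (hasDerivAt_id y))

theorem SmoothF.pdx_eq {f : SF} (hf : SmoothF f) :
    pdx f = fun x y => fderiv ℝ (fun q : ℝ × ℝ => f q.1 q.2) (x, y) (1, 0) :=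
  funext fun x => funext fun y => (hf.hasDerivAt_fst x y).deriv

theorem SmoothF.pdy_eq {f : SF} (hf : SmoothF f) :
    pdy f = fun x y => fderiv ℝ (fun q : ℝ × ℝ => f q.1 q.2) (x, y) (0, 1) :=
  funext fun x => funext fun y => (hf.hasDerivAt_snd x y).deriv

theorem SmoothF.contDiff_fderiv {f : SF} (hf : SmoothF f) :
    ContDiff ℝ (⊤ : ℕ∞) (fderiv ℝ (fun q : ℝ × ℝ => f q.1 q.2)) :=
  hf.contDiff_infty.fderiv_right le_rfl

protected theorem SmoothF.pdx {f : SF} (hf : SmoothF f) : SmoothF (pdx f) := by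
  refine ⟨fun n => ?_, fun y => (hf.smoothP y).deriv.2⟩
  rw [hf.pdx_eq]
  exact (contDiff_infty.1 hf.contDiff_fderiv n).clm_apply contDiff_const

protected theorem SmoothF.pdy {f : SF} (hf : SmoothF f) : SmoothF (pdy f) := by
  refine ⟨fun n => ?_, fun y x => ?_⟩
  · rw [hf.pdy_eq]
    exact (contDiff_infty.1 hf.contDiff_fderiv n).clm_apply contDiff_const
  · have : (fun s => f (x + 1) s) = fun s => f x s := funext fun s => hf.2 s x
    simp only [pdy, this]

theorem SmoothF.pdy_pdx {f : SF} (hf : SmoothF f) : pdy (pdx f) = pdx (pdy f) := by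
  funext x y
  have hd : ∀ v : ℝ × ℝ, HasFDerivAt
      (fun q : ℝ × ℝ => fderiv ℝ (fun q : ℝ × ℝ => f q.1 q.2) q v)
      ((fderiv ℝ (fderiv ℝ (fun q : ℝ × ℝ => f q.1 q.2)) (x, y)).flip v) (x, y) := fun v =>
    ((ContinuousLinearMap.apply ℝ ℝ v).hasFDerivAt.comp (x, y)
      (hf.contDiff_fderiv.differentiable (by simp) (x, y)).hasFDerivAt)
  have hsymm := (hf.1 2).contDiffAt.isSymmSndFDerivAt (x := (x, y)) (by simp)
  rw [hf.pdx.pdy_eq, hf.pdy.pdx_eq, hf.pdx_eq, hf.pdy_eq]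
  simp only [(hd _).fderiv, ContinuousLinearMap.flip_apply]
  exact hsymm _ _

protected theorem SmoothF.pdxn {f : SF} (hf : SmoothF f) (n : ℕ) : SmoothF (pdxn n f) := by
  induction n with
  | zero => exact hf
  | succ n ih =>
    rw [pdxn, Function.iterate_succ_apply']
    exact ih.pdx

theorem SmoothF.pdy_pdxn {f : SF} (hf : SmoothF f) (n : ℕ) :
    pdy (pdxn n f) = pdxn n (pdy f) := by
  induction n with
  | zero => rfl
  | succ n ih =>
    rw [pdxn, pdxn, Function.iterate_succ_apply', Function.iterate_succ_apply', ← pdxn, ← pdxn,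
      (hf.pdxn n).pdy_pdx, ih]

theorem pdxn_apply (n : ℕ) (f : SF) (x y : ℝ) :
    pdxn n f x y = iteratedDeriv n (fun s => f s y) x := by
  induction n generalizing x with
  | zero => rfl
  | succ n ih =>
    rw [pdxn, Function.iterate_succ_apply', ← pdxn, iteratedDeriv_succ]
    simp only [pdx, ih]

theorem nSq_nonneg (f : SF) : 0 ≤ nSq f :=
  intervalIntegral.integral_nonneg zero_le_one fun _ _ =>
    intervalIntegral.integral_nonneg zero_le_one fun _ _ => sq_nonneg _

theorem SmoothF.continuous_integral_snd {f : SF} (hf : SmoothF f) :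
    Continuous fun x => ∫ y in (0:ℝ)..1, f x y ^ 2 :=
  intervalIntegral.continuous_parametric_intervalIntegral_of_continuous'
    (hf.continuous_uncurry.pow 2) 0 1

theorem SmoothF.continuous_integral_fst {f : SF} (hf : SmoothF f) :
    Continuous fun y => ∫ x in (0:ℝ)..1, f x y ^ 2 :=
  intervalIntegral.continuous_parametric_intervalIntegral_of_continuous' (f := fun y x => f x y ^ 2)
    (by exact (hf.continuous_uncurry.comp continuous_swap).pow 2) 0 1

theorem SmoothF.nSq_eq_integral_swap {f : SF} (hf : SmoothF f) :
    nSq f = ∫ y in (0:ℝ)..1, ∫ x in (0:ℝ)..1, f x y ^ 2 := by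
  refine intervalIntegral_intervalIntegral_swap ?_
  rw [Set.uIoc_of_le zero_le_one]
  exact ((hf.continuous_uncurry.pow 2).continuousOn.integrableOn_compact
    (isCompact_Icc.prod isCompact_Icc)).mono_set
    (Set.prod_mono Set.Ioc_subset_Icc_self Set.Ioc_subset_Icc_self)

theorem SmoothF.integral_sq_le {g : SF} (hg : SmoothF g) {y : ℝ} (hy : y ∈ Set.Icc (0:ℝ) 1) :
    ∫ x in (0:ℝ)..1, g x y ^ 2 ≤ 2 * (nSq g + nSq (pdy g)) := by
  have c0 := hg.continuous_integral_snd
  have c1 := hg.pdy.continuous_integral_snd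
  have c2 := (hg.smoothP y).continuous
  rw [nSq, nSq, ← intervalIntegral.integral_add (c0.intervalIntegrable _ _)
    (c1.intervalIntegrable _ _), ← intervalIntegral.integral_const_mul]
  refine intervalIntegral.integral_mono_on zero_le_one
    (Continuous.intervalIntegrable (by fun_prop) _ _)
    (Continuous.intervalIntegrable (by fun_prop) _ _) fun x _ => ?_
  exact sq_le_integral_sq_add (g := fun s => g x s) (g' := fun s => pdy g x s)
    (fun s => (hg.hasDerivAt_snd x s).differentiableAt.hasDerivAt)
    (hg.pdy.continuous_uncurry.comp (by fun_prop : Continuous fun s : ℝ => (x, s))) hy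

theorem exists_mem_Icc_eq_of_periodic {g : ℝ → ℝ} (hg : Function.Periodic g 1) (x : ℝ) :
    ∃ t ∈ Set.Icc (0:ℝ) 1, g x = g t :=
  ⟨Int.fract x, ⟨Int.fract_nonneg x, (Int.fract_lt_one x).le⟩, by
    rw [Int.fract]; simpa using (hg.sub_int_mul_eq (x := x) ⌊x⌋).symm⟩

theorem SmoothF.abs_le_sqrt {f : SF} (hf : SmoothF f) (x y : ℝ) :
    |f x y| ≤ √(2 * ((∫ t in (0:ℝ)..1, f t y ^ 2) + ∫ t in (0:ℝ)..1, pdx f t y ^ 2)) := by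
  obtain ⟨t, ht, e⟩ := exists_mem_Icc_eq_of_periodic (hf.2 y) x
  rw [e]
  exact Real.abs_le_sqrt (sq_le_integral_sq_add (g := fun s => f s y)
    (fun s => (hf.smoothP y).hasDerivAt s) (hf.smoothP y).deriv.continuous ht)

theorem linf_nonneg (f : SF) : 0 ≤ linf f := Real.iSup_nonneg fun _ => abs_nonneg _

theorem SmoothF.abs_le_linf {f : SF} (hf : SmoothF f) (x : ℝ) {y : ℝ}
    (hy : y ∈ Set.Icc (0:ℝ) 1) : |f x y| ≤ linf f := by
  obtain ⟨t, ht, e⟩ := exists_mem_Icc_eq_of_periodic (hf.2 y) x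
  rw [e]
  have hc : Continuous fun q : Set.Icc (0:ℝ) 1 × Set.Icc (0:ℝ) 1 => |f q.1.1 q.2.1| :=
    (hf.continuous_uncurry.comp (by fun_prop :
      Continuous fun q : Set.Icc (0:ℝ) 1 × Set.Icc (0:ℝ) 1 => (q.1.1, q.2.1))).abs
  exact le_ciSup (f := fun q : Set.Icc (0:ℝ) 1 × Set.Icc (0:ℝ) 1 => |f q.1.1 q.2.1|)
    (isCompact_range hc).bddAbove (⟨t, ht⟩, ⟨y, hy⟩)

theorem SmoothF.nSq_le_of_slices {h p f : SF} (hh : SmoothF h) (hp : SmoothF p) (hf : SmoothF f)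
    {α β : ℝ} (H : ∀ y ∈ Set.Icc (0:ℝ) 1, ∫ x in (0:ℝ)..1, h x y ^ 2 ≤
      α * (∫ x in (0:ℝ)..1, p x y ^ 2) +
        β * ((∫ x in (0:ℝ)..1, f x y ^ 2) + ∫ x in (0:ℝ)..1, pdx f x y ^ 2)) :
    nSq h ≤ α * nSq p + β * (nSq f + nSq (pdx f)) := by
  have c0 := hh.continuous_integral_fst
  have c1 := hp.continuous_integral_fst
  have c2 := hf.continuous_integral_fst
  have c3 := hf.pdx.continuous_integral_fst
  rw [hh.nSq_eq_integral_swap, hp.nSq_eq_integral_swap, hf.nSq_eq_integral_swap,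
    hf.pdx.nSq_eq_integral_swap, ← intervalIntegral.integral_add (c2.intervalIntegrable _ _)
    (c3.intervalIntegrable _ _), ← intervalIntegral.integral_const_mul,
    ← intervalIntegral.integral_const_mul, ← intervalIntegral.integral_add
    (Continuous.intervalIntegrable (by fun_prop) _ _)
    (Continuous.intervalIntegrable (by fun_prop) _ _)]
  exact intervalIntegral.integral_mono_on zero_le_one
    (Continuous.intervalIntegrable (by fun_prop) _ _)
    (Continuous.intervalIntegrable (by fun_prop) _ _) H

theorem add_le_sqrt_add_sqrt_sq {s t : ℝ} (hs : 0 ≤ s) (ht : 0 ≤ t) :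
    s + t ≤ (√s + √t) ^ 2 := by
  nlinarith [Real.sq_sqrt hs, Real.sq_sqrt ht, Real.sqrt_nonneg s, Real.sqrt_nonneg t,
    mul_nonneg (Real.sqrt_nonneg s) (Real.sqrt_nonneg t)]

/-- **Lemma 5.2 (anisotropic product estimates).** For any integer `k ≥ 0` and
sufficiently smooth `a`, `b`, `f` on `Ω`:
(i)  `‖∂_x^k(af)‖ ≲ ‖a‖_∞‖∂_x^k f‖ + (‖∂_x^k a‖+‖∂_x^k a_y‖)(‖f‖+‖f_x‖)`;
(ii) `‖∂_x^k(abf)‖ ≲ ‖a‖_∞‖b‖_∞‖∂_x^k f‖ + ‖b‖_∞(‖∂_x^k a‖+‖∂_x^k a_y‖)(‖f‖+‖f_x‖)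
      + ‖a‖_∞(‖∂_x^k b‖+‖∂_x^k b_y‖)(‖f‖+‖f_x‖)`.
The implicit constants depend only on `k`. -/
theorem product_estimates (k : ℕ) :
    ∃ C : ℝ, 0 < C ∧ ∀ a b f : SF, SmoothF a → SmoothF b → SmoothF f →
      (Real.sqrt (nSq (pdxn k (fun x y => a x y * f x y))) ≤
          C * (linf a * Real.sqrt (nSq (pdxn k f)) +
            (Real.sqrt (nSq (pdxn k a)) + Real.sqrt (nSq (pdxn k (pdy a)))) *
              (Real.sqrt (nSq f) + Real.sqrt (nSq (pdx f))))) ∧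
      (Real.sqrt (nSq (pdxn k (fun x y => a x y * b x y * f x y))) ≤
          C * (linf a * linf b * Real.sqrt (nSq (pdxn k f)) +
            linf b * (Real.sqrt (nSq (pdxn k a)) + Real.sqrt (nSq (pdxn k (pdy a)))) *
              (Real.sqrt (nSq f) + Real.sqrt (nSq (pdx f))) +
            linf a * (Real.sqrt (nSq (pdxn k b)) + Real.sqrt (nSq (pdxn k (pdy b)))) *
              (Real.sqrt (nSq f) + Real.sqrt (nSq (pdx f))))) := by
  obtain ⟨C, hC, hM⟩ := SmoothP.integral_iteratedDeriv_mul_sq_le k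
  set D := 4 * (C + 1) ^ 2 with hD
  have hD0 : 0 ≤ D := by positivity
  have hCD : C ≤ D := by nlinarith
  have hCD4 : 4 * C ≤ D := by nlinarith
  have hCD2 : 4 * C ^ 2 ≤ D := by nlinarith
  refine ⟨√D, Real.sqrt_pos.2 (by positivity), fun a b f ha hb hf => ?_⟩
  have hA := linf_nonneg a
  have hB := linf_nonneg b
  have slice : ∀ g : SF, SmoothF g → ∀ y ∈ Set.Icc (0:ℝ) 1,
      ∫ x in (0:ℝ)..1, iteratedDeriv k (fun s => g s y) x ^ 2 ≤
        2 * (√(nSq (pdxn k g)) + √(nSq (pdxn k (pdy g)))) ^ 2 := by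
    intro g hg y hy
    have h := (hg.pdxn k).integral_sq_le hy
    simp only [pdxn_apply k g, hg.pdy_pdxn] at h
    exact h.trans (mul_le_mul_of_nonneg_left
      (add_le_sqrt_add_sqrt_sq (nSq_nonneg _) (nSq_nonneg _)) zero_le_two)
  have slice_nonneg : ∀ (g : SF) (y : ℝ), 0 ≤ ∫ x in (0:ℝ)..1, g x y ^ 2 := fun g y =>
    intervalIntegral.integral_nonneg zero_le_one fun _ _ => sq_nonneg _
  set Na := √(nSq (pdxn k a)) + √(nSq (pdxn k (pdy a)))
  set Nb := √(nSq (pdxn k b)) + √(nSq (pdxn k (pdy b)))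
  have hNa : 0 ≤ Na := by positivity
  have hNb : 0 ≤ Nb := by positivity
  have hNf1 : 0 ≤ nSq f + nSq (pdx f) := add_nonneg (nSq_nonneg _) (nSq_nonneg _)
  have hNf := add_le_sqrt_add_sqrt_sq (nSq_nonneg f) (nSq_nonneg (pdx f))
  set Nf := √(nSq f) + √(nSq (pdx f))
  have hNf0 : 0 ≤ Nf := by positivity
  have hq : nSq (pdxn k f) = √(nSq (pdxn k f)) ^ 2 := (Real.sq_sqrt (nSq_nonneg _)).symm
  set q := √(nSq (pdxn k f))
  have hq0 : 0 ≤ q := Real.sqrt_nonneg _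
  constructor
  · have h1 : nSq (pdxn k fun x y => a x y * f x y) ≤
        C * linf a ^ 2 * nSq (pdxn k f) + 4 * C * Na ^ 2 * (nSq f + nSq (pdx f)) := by
      refine SmoothF.nSq_le_of_slices ((ha.mul hf).pdxn k) (hf.pdxn k) hf fun y hy => ?_
      have h := hM _ _ _ _ (ha.smoothP y) (hf.smoothP y) (fun x => ha.abs_le_linf x hy)
        (fun x => hf.abs_le_sqrt x y)
      have hF := add_nonneg (slice_nonneg f y) (slice_nonneg (pdx f) y)
      rw [Real.sq_sqrt (by positivity)] at h
      simp only [pdxn_apply k]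
      refine h.trans ?_
      have h2 := mul_le_mul_of_nonneg_left (slice a ha y hy) (mul_nonneg hC hF)
      linarith
    rw [← Real.sqrt_sq (by positivity : 0 ≤ linf a * q + Na * Nf), ← Real.sqrt_mul hD0]
    refine Real.sqrt_le_sqrt (h1.trans ?_)
    rw [hq]
    calc _ ≤ D * linf a ^ 2 * q ^ 2 + D * Na ^ 2 * Nf ^ 2 := by gcongr
      _ ≤ _ := by nlinarith [(by positivity : 0 ≤ D * ((linf a * q) * (Na * Nf)))]
  · have h1 : nSq (pdxn k fun x y => a x y * b x y * f x y) ≤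
        C * (linf a * linf b) ^ 2 * nSq (pdxn k f) +
          4 * C ^ 2 * (linf b ^ 2 * Na ^ 2 + linf a ^ 2 * Nb ^ 2) * (nSq f + nSq (pdx f)) := by
      refine SmoothF.nSq_le_of_slices (((ha.mul hb).mul hf).pdxn k) (hf.pdxn k) hf
        fun y hy => ?_
      have hab : ∀ x, |a x y * b x y| ≤ linf a * linf b := fun x => by
        rw [abs_mul]
        exact mul_le_mul (ha.abs_le_linf x hy) (hb.abs_le_linf x hy) (abs_nonneg _) hA
      have h := hM _ _ _ _ ((ha.mul hb).smoothP y) (hf.smoothP y) hab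
        (fun x => hf.abs_le_sqrt x y)
      have h' := hM _ _ _ _ (ha.smoothP y) (hb.smoothP y) (fun x => ha.abs_le_linf x hy)
        (fun x => hb.abs_le_linf x hy)
      have hF := add_nonneg (slice_nonneg f y) (slice_nonneg (pdx f) y)
      rw [Real.sq_sqrt (by positivity)] at h
      simp only [pdxn_apply k]
      refine h.trans ?_
      have h2 := mul_le_mul_of_nonneg_left (slice a ha y hy) (sq_nonneg (linf b))
      have h3 := mul_le_mul_of_nonneg_left (slice b hb y hy) (sq_nonneg (linf a))
      have h4 := h'.trans (mul_le_mul_of_nonneg_left (add_le_add h3 h2) hC)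
      have h5 := mul_le_mul_of_nonneg_left h4 (mul_nonneg hC hF)
      linarith
    rw [← Real.sqrt_sq (by positivity :
      0 ≤ linf a * linf b * q + linf b * Na * Nf + linf a * Nb * Nf), ← Real.sqrt_mul hD0]
    refine Real.sqrt_le_sqrt (h1.trans ?_)
    rw [hq]
    calc _ ≤ D * (linf a * linf b) ^ 2 * q ^ 2 +
          D * (linf b ^ 2 * Na ^ 2 + linf a ^ 2 * Nb ^ 2) * Nf ^ 2 := by gcongr
      _ ≤ _ := by
        have hX : 0 ≤ linf a * linf b * q := by positivity
        have hY : 0 ≤ linf b * Na * Nf := by positivity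
        have hZ : 0 ≤ linf a * Nb * Nf := by positivity
        have hcross : 0 ≤ 2 * D * ((linf a * linf b * q) * (linf b * Na * Nf) +
            (linf a * linf b * q) * (linf a * Nb * Nf) +
            (linf b * Na * Nf) * (linf a * Nb * Nf)) := by positivity
        refine (le_add_of_nonneg_right hcross).trans (le_of_eq ?_)
        ring
end
end
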